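/- arXiv:1704.08173 — 5 statements merged into one kernel-verified Lean document; each statement's English description precedes it below -/
import Mathlib

section
/- Let i, j be indices with [i] + [j] even (i.e. either both i, j ≤ m or both i, j > m). Then for all u, v ∈ ℂ with u ≠ v and u − v + c ≠ 0 one has T_{i,j}(u)T_{i,j}(v) = T_{i,j}(v)T_{i,j}(u). -/
noncomputable section

namespace Stmt9

/-- ℤ₂-grading of indices: `[i] = 0` for `i ≤ m`, `[i] = 1` for `i > m`. -/
def gr (m i : ℕ) : ℕ := if i ≤ m then 0 else 1

def g (c u v : ℂ) : ℂ := c / (u - v)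

/-- For `[i] + [j]` even, the operators `T_{i,j}(u)` and `T_{i,j}(v)` commute. -/
theorem even_operators_commute {A : Type*} [Ring A] [Algebra ℂ A]
    (c : ℂ) (hc : c ≠ 0) (m n : ℕ) (hm : 1 ≤ m) (hn : 1 ≤ n)
    (T : ℕ → ℕ → ℂ → A)
    (hRTT : ∀ u v : ℂ, u ≠ v → ∀ i j k l : ℕ,
      1 ≤ i → i ≤ m + n → 1 ≤ j → j ≤ m + n → 1 ≤ k → k ≤ m + n → 1 ≤ l → l ≤ m + n →
      (T i j u * T k l v
          - ((-1 : ℂ) ^ ((gr m i + gr m j) * (gr m k + gr m l))) • (T k l v * T i j u)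
        = (((-1 : ℂ) ^ (gr m i * (gr m k + gr m l) + gr m k * gr m l)) * g c u v) •
            (T k j v * T i l u - T k j u * T i l v))
      ∧ (T i j u * T k l v
          - ((-1 : ℂ) ^ ((gr m i + gr m j) * (gr m k + gr m l))) • (T k l v * T i j u)
        = (((-1 : ℂ) ^ (gr m l * (gr m i + gr m j) + gr m i * gr m j)) * g c u v) •
            (T i l u * T k j v - T i l v * T k j u))) :
    ∀ i j : ℕ, 1 ≤ i → i ≤ m + n → 1 ≤ j → j ≤ m + n → (gr m i + gr m j) % 2 = 0 →
    ∀ u v : ℂ, u ≠ v → u - v + c ≠ 0 →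
      T i j u * T i j v = T i j v * T i j u := by
  intro i j hi hi' hj hj' hpar u v huv hne
  have huv' : u - v ≠ 0 := sub_ne_zero.mpr huv
  have hg : 1 + g c u v ≠ 0 := by
    have h1 : 1 + g c u v = (u - v + c) / (u - v) := by
      unfold g
      field_simp
    rw [h1]
    exact div_ne_zero hne huv'
  obtain ⟨h1, h2⟩ := hRTT u v huv i j i j hi hi' hj hj' hi hi' hj hj'
  have key : (1 + g c u v) • (T i j u * T i j v - T i j v * T i j u) = 0 := by
    by_cases a : i ≤ m <;> by_cases b : j ≤ m <;> simp [gr, a, b] at hpar h1 h2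
    · rw [add_smul, one_smul]
      nth_rewrite 1 [h1]
      rw [← smul_add]
      simp
    · rw [add_smul, one_smul]
      have e4 : (-1 : ℂ) ^ 4 = 1 := by norm_num
      have e3 : (-1 : ℂ) ^ 3 = -1 := by norm_num
      rw [e4, e3, one_smul, neg_one_mul, neg_smul] at h2
      exact eq_neg_iff_add_eq_zero.mp h2
  exact sub_eq_zero.mp ((smul_eq_zero_iff_right hg).mp key)

end Stmt9
end
end

section
/- For every index i with 2 ≤ i ≤ m+n and all u, v ∈ ℂ with u ≠ v, one has T_{i,i}(u)T_{i−1,i}(v) = f_{[i]}(u,v) T_{i−1,i}(v) T_{i,i}(u) + g_{[i]}(v,u) T_{i−1,i}(u) T_{i,i}(v). -/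
noncomputable section

namespace Stmt11

/-- ℤ₂-grading of indices: `[i] = 0` for `i ≤ m`, `[i] = 1` for `i > m`. -/
def gr (m i : ℕ) : ℕ := if i ≤ m then 0 else 1

def g (c u v : ℂ) : ℂ := c / (u - v)

/-- graded function `g_{[i]}(u,v) = (-1)^{[i]} c/(u-v)`. -/
def gb (c : ℂ) (m i : ℕ) (u v : ℂ) : ℂ := (-1 : ℂ) ^ gr m i * c / (u - v)

/-- graded function `f_{[i]}(u,v) = (u - v + (-1)^{[i]} c)/(u - v)`. -/
def fb (c : ℂ) (m i : ℕ) (u v : ℂ) : ℂ := (u - v + (-1 : ℂ) ^ gr m i * c) / (u - v)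

/-- `T_{i,i}(u) T_{i-1,i}(v) = f_{[i]}(u,v) T_{i-1,i}(v) T_{i,i}(u) + g_{[i]}(v,u) T_{i-1,i}(u) T_{i,i}(v)`. -/
theorem comm_Tii_Tim1i {A : Type*} [Ring A] [Algebra ℂ A]
    (c : ℂ) (hc : c ≠ 0) (m n : ℕ) (hm : 1 ≤ m) (hn : 1 ≤ n)
    (T : ℕ → ℕ → ℂ → A)
    (hRTT : ∀ u v : ℂ, u ≠ v → ∀ i j k l : ℕ,
      1 ≤ i → i ≤ m + n → 1 ≤ j → j ≤ m + n → 1 ≤ k → k ≤ m + n → 1 ≤ l → l ≤ m + n →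
      (T i j u * T k l v
          - ((-1 : ℂ) ^ ((gr m i + gr m j) * (gr m k + gr m l))) • (T k l v * T i j u)
        = (((-1 : ℂ) ^ (gr m i * (gr m k + gr m l) + gr m k * gr m l)) * g c u v) •
            (T k j v * T i l u - T k j u * T i l v))
      ∧ (T i j u * T k l v
          - ((-1 : ℂ) ^ ((gr m i + gr m j) * (gr m k + gr m l))) • (T k l v * T i j u)
        = (((-1 : ℂ) ^ (gr m l * (gr m i + gr m j) + gr m i * gr m j)) * g c u v) •
            (T i l u * T k j v - T i l v * T k j u))) :
    ∀ i : ℕ, 2 ≤ i → i ≤ m + n → ∀ u v : ℂ, u ≠ v →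
      T i i u * T (i - 1) i v
        = fb c m i u v • (T (i - 1) i v * T i i u)
          + gb c m i v u • (T (i - 1) i u * T i i v) := by
  intro i hi him u v huv
  have h := (hRTT u v huv i i (i - 1) i (by omega) him (by omega) him (by omega) (by omega)
    (by omega) him).1
  have huv' : u - v ≠ 0 := sub_ne_zero.mpr huv
  have hs : (-1 : ℂ) ^ ((gr m i + gr m i) * (gr m (i - 1) + gr m i)) = 1 := by
    rw [pow_mul, ← two_mul, pow_mul]; simp
  have ht : (-1 : ℂ) ^ (gr m i * (gr m (i - 1) + gr m i) + gr m (i - 1) * gr m i)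
      = (-1) ^ gr m i := by
    unfold gr; split_ifs <;> norm_num
  rw [hs, ht, one_smul, sub_eq_iff_eq_add] at h
  have hf : fb c m i u v = 1 + (-1) ^ gr m i * g c u v := by
    unfold fb g; field_simp
  have hg : gb c m i v u = -((-1) ^ gr m i * g c u v) := by
    unfold gb g
    rw [← neg_sub u v, div_neg, mul_div_assoc]
  rw [h, hf, hg]
  module

end Stmt11
end
end

section
/- Let 1 ≤ j < i, let i < k ≤ m+n, and let ℓ be any index with j < ℓ ≤ m+n. Let t^ν_a ∈ ℂ (for i ≤ ν ≤ k−1 and 1 ≤ a ≤ r_ν, with arbitrary nonnegative integers r_ν) and s ∈ ℂ be pairwise distinct complex numbers. Then T_{ℓ,j}(s) · T_{i,i+1}(t^i_1)···T_{i,i+1}(t^i_{r_i}) · T_{i+1,i+2}(t^{i+1}_1)···T_{i+1,i+2}(t^{i+1}_{r_{i+1}}) ··· T_{k−1,k}(t^{k−1}_1)···T_{k−1,k}(t^{k−1}_{r_{k−1}}) |0⟩ = 0. -/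
noncomputable section

namespace Stmt13

/-- ℤ₂-grading of indices: `[i] = 0` for `i ≤ m`, `[i] = 1` for `i > m`. -/
def gr (m i : ℕ) : ℕ := if i ≤ m then 0 else 1

def g (c u v : ℂ) : ℂ := c / (u - v)

/-- The list version: induction over the list of creation operators. -/
theorem list_aux {H : Type*} [AddCommGroup H] [Module ℂ H]
    (c : ℂ) (m n : ℕ)
    (T : ℕ → ℕ → ℂ → Module.End ℂ H)
    (hRTT : ∀ u v : ℂ, u ≠ v → ∀ i j k l : ℕ,
      1 ≤ i → i ≤ m + n → 1 ≤ j → j ≤ m + n → 1 ≤ k → k ≤ m + n → 1 ≤ l → l ≤ m + n →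
      (T i j u * T k l v
          - ((-1 : ℂ) ^ ((gr m i + gr m j) * (gr m k + gr m l))) • (T k l v * T i j u)
        = (((-1 : ℂ) ^ (gr m l * (gr m i + gr m j) + gr m i * gr m j)) * g c u v) •
            (T i l u * T k j v - T i l v * T k j u)))
    (vac : H)
    (j : ℕ) (hj1 : 1 ≤ j)
    (hann : ∀ i, j < i → i ≤ m + n → ∀ u : ℂ, T i j u vac = 0)
    (L : List (ℕ × ℂ)) (hL : ∀ p ∈ L, j < p.1 ∧ p.1 + 1 ≤ m + n)
    (hP : L.Pairwise (fun p q => p.2 ≠ q.2)) :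
    ∀ l, j < l → l ≤ m + n → ∀ s : ℂ, (∀ p ∈ L, p.2 ≠ s) →
      T l j s ((L.map (fun p => T p.1 (p.1 + 1) p.2)).prod vac) = 0 := by
  induction L with
  | nil => intro l h1 h2 s _; simpa using hann l h1 h2 s
  | cons p L ih =>
    intro l h1 h2 s hs
    rw [List.pairwise_cons] at hP
    have ih' := ih (fun q hq => hL q (List.mem_cons_of_mem _ hq)) hP.2
    obtain ⟨hp1, hp2⟩ := hL p List.mem_cons_self
    have hsL : ∀ q ∈ L, q.2 ≠ s := fun q hq => hs q (List.mem_cons_of_mem _ hq)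
    have hps : s ≠ p.2 := (hs p List.mem_cons_self).symm
    have key := hRTT s p.2 hps l j p.1 (p.1 + 1) (by omega) h2 hj1 (by omega) (by omega)
      (by omega) (by omega) hp2
    rw [sub_eq_iff_eq_add] at key
    have key2 := congrArg
      (fun f : Module.End ℂ H => f ((L.map (fun p => T p.1 (p.1 + 1) p.2)).prod vac)) key
    simp only [LinearMap.add_apply, LinearMap.smul_apply, LinearMap.sub_apply,
      Module.End.mul_apply, ih' l h1 h2 s hsL, ih' p.1 hp1 (by omega) s hsL,
      ih' p.1 hp1 (by omega) p.2 (fun q hq => (hP.1 q hq).symm), map_zero, sub_zero, smul_zero,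
      add_zero] at key2
    simpa only [List.map_cons, List.prod_cons, Module.End.mul_apply] using key2

/-- Lemma B.1: for `j < i` and `j < ℓ`, the operator `T_{ℓ,j}(s)` annihilates the vector
`T_{i,i+1}(t^i_1)⋯T_{i,i+1}(t^i_{r_i}) ⋯ T_{k-1,k}(t^{k-1}_1)⋯T_{k-1,k}(t^{k-1}_{r_{k-1}}) |0⟩`. -/
theorem Tlj_annihilates {H : Type*} [AddCommGroup H] [Module ℂ H]
    (c : ℂ) (hc : c ≠ 0) (m n : ℕ) (hm : 1 ≤ m) (hn : 1 ≤ n)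
    (T : ℕ → ℕ → ℂ → Module.End ℂ H)
    (hRTT : ∀ u v : ℂ, u ≠ v → ∀ i j k l : ℕ,
      1 ≤ i → i ≤ m + n → 1 ≤ j → j ≤ m + n → 1 ≤ k → k ≤ m + n → 1 ≤ l → l ≤ m + n →
      (T i j u * T k l v
          - ((-1 : ℂ) ^ ((gr m i + gr m j) * (gr m k + gr m l))) • (T k l v * T i j u)
        = (((-1 : ℂ) ^ (gr m i * (gr m k + gr m l) + gr m k * gr m l)) * g c u v) •
            (T k j v * T i l u - T k j u * T i l v))
      ∧ (T i j u * T k l v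
          - ((-1 : ℂ) ^ ((gr m i + gr m j) * (gr m k + gr m l))) • (T k l v * T i j u)
        = (((-1 : ℂ) ^ (gr m l * (gr m i + gr m j) + gr m i * gr m j)) * g c u v) •
            (T i l u * T k j v - T i l v * T k j u)))
    (vac : H) (lam : ℕ → ℂ → ℂ)
    (hdiag : ∀ i, 1 ≤ i → i ≤ m + n → ∀ u : ℂ, T i i u vac = lam i u • vac)
    (hann : ∀ i j, 1 ≤ j → j < i → i ≤ m + n → ∀ u : ℂ, T i j u vac = 0)
    (i j k : ℕ) (hj1 : 1 ≤ j) (hji : j < i) (hik : i < k) (hk : k ≤ m + n)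
    (l : ℕ) (hl1 : j < l) (hl2 : l ≤ m + n)
    (r : ℕ → ℕ) (t : ℕ → ℕ → ℂ) (s : ℂ)
    (hdist : ∀ ν a ν' a' : ℕ, i ≤ ν → ν ≤ k - 1 → 1 ≤ a → a ≤ r ν →
      i ≤ ν' → ν' ≤ k - 1 → 1 ≤ a' → a' ≤ r ν' → (ν, a) ≠ (ν', a') → t ν a ≠ t ν' a')
    (hsdist : ∀ ν a : ℕ, i ≤ ν → ν ≤ k - 1 → 1 ≤ a → a ≤ r ν → t ν a ≠ s) :
    T l j s
      (((List.range (k - i)).map (fun d =>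
        ((List.range (r (i + d))).map
          (fun a => T (i + d) (i + d + 1) (t (i + d) (a + 1)))).prod)).prod vac) = 0 := by
  have key := list_aux c m n T
    (fun u v huv a b d e h1 h2 h3 h4 h5 h6 h7 h8 =>
      (hRTT u v huv a b d e h1 h2 h3 h4 h5 h6 h7 h8).2)
    vac j hj1 (fun a h1 h2 u => hann a j hj1 h1 h2 u)
    ((List.range (k - i)).flatMap (fun d =>
      (List.range (r (i + d))).map (fun a => ((i + d, t (i + d) (a + 1)) : ℕ × ℂ))))
    (by
      intro p hp
      simp only [List.mem_flatMap, List.mem_map, List.mem_range] at hp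
      obtain ⟨d, hd, a, ha, rfl⟩ := hp
      constructor <;> dsimp only <;> omega)
    (by
      rw [List.pairwise_flatMap]
      refine ⟨?_, ?_⟩
      · intro d hd
        rw [List.mem_range] at hd
        rw [List.pairwise_map]
        refine List.Pairwise.imp_of_mem ?_ (List.pairwise_lt_range (n := r (i + d)))
        intro a b ha hb hab
        rw [List.mem_range] at ha hb
        refine hdist _ _ _ _ (by omega) (by omega) (by omega) (by omega) (by omega) (by omega)
          (by omega) (by omega) ?_
        intro h
        have := (Prod.mk.inj h).2
        omega
      · refine List.Pairwise.imp_of_mem ?_ (List.pairwise_lt_range (n := k - i))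
        intro d e hd he hde p hp q hq
        rw [List.mem_range] at hd he
        simp only [List.mem_map, List.mem_range] at hp hq
        obtain ⟨a, ha, rfl⟩ := hp
        obtain ⟨b, hb, rfl⟩ := hq
        refine hdist _ _ _ _ (by omega) (by omega) (by omega) (by omega) (by omega) (by omega)
          (by omega) (by omega) ?_
        intro h
        have := (Prod.mk.inj h).1
        omega)
    l hl1 hl2 s
    (by
      intro p hp
      simp only [List.mem_flatMap, List.mem_map, List.mem_range] at hp
      obtain ⟨d, hd, a, ha, rfl⟩ := hp
      exact hsdist _ _ (by omega) (by omega) (by omega) (by omega))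
  simpa only [List.flatMap_def, List.map_flatten, List.prod_flatten, List.map_map,
    Function.comp_def] using key

end Stmt13
end
end

section
/- Let 1 ≤ j < i and i < k ≤ m+n. Let t^ν_a ∈ ℂ (for i ≤ ν ≤ k−1 and 1 ≤ a ≤ r_ν, with arbitrary nonnegative integers r_ν) and s ∈ ℂ be pairwise distinct complex numbers, and let Φ = T_{i,i+1}(t^i_1)···T_{i,i+1}(t^i_{r_i}) · T_{i+1,i+2}(t^{i+1}_1)···T_{i+1,i+2}(t^{i+1}_{r_{i+1}}) ··· T_{k−1,k}(t^{k−1}_1)···T_{k−1,k}(t^{k−1}_{r_{k−1}}) |0⟩. Then T_{j,j}(s) Φ = λ_j(s) Φ. -/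
noncomputable section

namespace Stmt14

/-- ℤ₂-grading of indices: `[i] = 0` for `i ≤ m`, `[i] = 1` for `i > m`. -/
def gr (m i : ℕ) : ℕ := if i ≤ m then 0 else 1

def g (c u v : ℂ) : ℂ := c / (u - v)

/-- Product of the operators `T_{b,b+1}(v)` over a list of pairs `(b, v)`. -/
def opProd {H : Type*} [AddCommGroup H] [Module ℂ H]
    (T : ℕ → ℕ → ℂ → Module.End ℂ H) (L : List (ℕ × ℂ)) : Module.End ℂ H :=
  (L.map (fun p => T p.1 (p.1 + 1) p.2)).prod

/-- The exchange relation used, applied to a vector killed by the lowering operators. -/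
theorem exchange {H : Type*} [AddCommGroup H] [Module ℂ H]
    (A B C D E F : Module.End ℂ H) (x y : ℂ) (w : H)
    (h : A * B - x • (B * A) = y • (C * D - E * F)) (hD : D w = 0) (hF : F w = 0) :
    A (B w) = x • B (A w) := by
  have h2 := congrArg (fun f : Module.End ℂ H => f w) h
  simp [hD, hF] at h2
  exact sub_eq_zero.mp h2

theorem main_aux {H : Type*} [AddCommGroup H] [Module ℂ H]
    (c : ℂ) (m N : ℕ)
    (T : ℕ → ℕ → ℂ → Module.End ℂ H)
    (hR : ∀ u v : ℂ, u ≠ v → ∀ i j k l : ℕ,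
      1 ≤ i → i ≤ N → 1 ≤ j → j ≤ N → 1 ≤ k → k ≤ N → 1 ≤ l → l ≤ N →
      (T i j u * T k l v
          - ((-1 : ℂ) ^ ((gr m i + gr m j) * (gr m k + gr m l))) • (T k l v * T i j u)
        = (((-1 : ℂ) ^ (gr m l * (gr m i + gr m j) + gr m i * gr m j)) * g c u v) •
            (T i l u * T k j v - T i l v * T k j u)))
    (vac : H) (lam : ℕ → ℂ → ℂ)
    (hdiag : ∀ i, 1 ≤ i → i ≤ N → ∀ u : ℂ, T i i u vac = lam i u • vac)
    (hann : ∀ i j, 1 ≤ j → j < i → i ≤ N → ∀ u : ℂ, T i j u vac = 0)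
    (j : ℕ) (hj1 : 1 ≤ j) (L : List (ℕ × ℂ))
    (hL : ∀ p ∈ L, j < p.1 ∧ p.1 + 1 ≤ N)
    (hd : L.Pairwise (fun p q => p.2 ≠ q.2)) (hjN : j ≤ N) :
    (∀ a, j < a → a ≤ N → ∀ u : ℂ, (∀ p ∈ L, u ≠ p.2) → T a j u (opProd T L vac) = 0) ∧
    (∀ u : ℂ, (∀ p ∈ L, u ≠ p.2) → T j j u (opProd T L vac) = lam j u • opProd T L vac) := by
  induction L with
  | nil =>
    refine ⟨fun a ha haN u _ => ?_, fun u _ => ?_⟩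
    · simpa [opProd] using hann a j hj1 ha haN u
    · simpa [opProd] using hdiag j hj1 hjN u
  | cons p L ih =>
    obtain ⟨b, v⟩ := p
    rw [List.pairwise_cons] at hd
    obtain ⟨ih1, ih2⟩ := ih (fun p hp => hL p (List.mem_cons_of_mem _ hp)) hd.2
    obtain ⟨hjb, hbN⟩ := hL (b, v) List.mem_cons_self
    simp only at hjb hbN
    have e : opProd T ((b, v) :: L) vac = T b (b + 1) v (opProd T L vac) := by
      simp [opProd]
    have hv := ih1 b hjb (by omega) v (fun q hq => hd.1 q hq)
    rw [e]
    have key : ∀ a, j ≤ a → a ≤ N → ∀ u : ℂ, (∀ p ∈ (b, v) :: L, u ≠ p.2) →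
        T a j u (T b (b + 1) v (opProd T L vac)) =
          ((-1 : ℂ) ^ ((gr m a + gr m j) * (gr m b + gr m (b + 1)))) •
            T b (b + 1) v (T a j u (opProd T L vac)) := by
      intro a ha haN u hu
      exact exchange _ _ _ _ _ _ _ _ _
        (hR u v (hu (b, v) List.mem_cons_self) a j b (b + 1) (by omega) haN hj1 hjN
          (by omega) (by omega) (by omega) hbN)
        hv (ih1 b hjb (by omega) u (fun q hq => hu q (List.mem_cons_of_mem _ hq)))
    refine ⟨fun a ha haN u hu => ?_, fun u hu => ?_⟩
    · rw [key a ha.le haN u hu, ih1 a ha haN u (fun q hq => hu q (List.mem_cons_of_mem _ hq))]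
      simp
    · rw [key j le_rfl hjN u hu, ih2 u (fun q hq => hu q (List.mem_cons_of_mem _ hq)),
        Even.neg_one_pow (Even.mul_right ⟨gr m j, rfl⟩ _)]
      simp

/-- Lemma B.2: for `j < i`, the diagonal operator `T_{j,j}(s)` acts on
`Φ = T_{i,i+1}(t^i_1)⋯T_{k-1,k}(t^{k-1}_{r_{k-1}}) |0⟩` as the scalar `λ_j(s)`. -/
theorem Tjj_eigen {H : Type*} [AddCommGroup H] [Module ℂ H]
    (c : ℂ) (hc : c ≠ 0) (m n : ℕ) (hm : 1 ≤ m) (hn : 1 ≤ n)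
    (T : ℕ → ℕ → ℂ → Module.End ℂ H)
    (hRTT : ∀ u v : ℂ, u ≠ v → ∀ i j k l : ℕ,
      1 ≤ i → i ≤ m + n → 1 ≤ j → j ≤ m + n → 1 ≤ k → k ≤ m + n → 1 ≤ l → l ≤ m + n →
      (T i j u * T k l v
          - ((-1 : ℂ) ^ ((gr m i + gr m j) * (gr m k + gr m l))) • (T k l v * T i j u)
        = (((-1 : ℂ) ^ (gr m i * (gr m k + gr m l) + gr m k * gr m l)) * g c u v) •
            (T k j v * T i l u - T k j u * T i l v))
      ∧ (T i j u * T k l v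
          - ((-1 : ℂ) ^ ((gr m i + gr m j) * (gr m k + gr m l))) • (T k l v * T i j u)
        = (((-1 : ℂ) ^ (gr m l * (gr m i + gr m j) + gr m i * gr m j)) * g c u v) •
            (T i l u * T k j v - T i l v * T k j u)))
    (vac : H) (lam : ℕ → ℂ → ℂ)
    (hdiag : ∀ i, 1 ≤ i → i ≤ m + n → ∀ u : ℂ, T i i u vac = lam i u • vac)
    (hann : ∀ i j, 1 ≤ j → j < i → i ≤ m + n → ∀ u : ℂ, T i j u vac = 0)
    (i j k : ℕ) (hj1 : 1 ≤ j) (hji : j < i) (hik : i < k) (hk : k ≤ m + n)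
    (r : ℕ → ℕ) (t : ℕ → ℕ → ℂ) (s : ℂ)
    (hdist : ∀ ν a ν' a' : ℕ, i ≤ ν → ν ≤ k - 1 → 1 ≤ a → a ≤ r ν →
      i ≤ ν' → ν' ≤ k - 1 → 1 ≤ a' → a' ≤ r ν' → (ν, a) ≠ (ν', a') → t ν a ≠ t ν' a')
    (hsdist : ∀ ν a : ℕ, i ≤ ν → ν ≤ k - 1 → 1 ≤ a → a ≤ r ν → t ν a ≠ s) :
    T j j s
      (((List.range (k - i)).map (fun d =>
        ((List.range (r (i + d))).map
          (fun a => T (i + d) (i + d + 1) (t (i + d) (a + 1)))).prod)).prod vac)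
      = lam j s • (((List.range (k - i)).map (fun d =>
        ((List.range (r (i + d))).map
          (fun a => T (i + d) (i + d + 1) (t (i + d) (a + 1)))).prod)).prod vac) := by
  have hflat : ((List.range (k - i)).map (fun d =>
        ((List.range (r (i + d))).map
          (fun a => T (i + d) (i + d + 1) (t (i + d) (a + 1)))).prod)).prod
      = opProd T ((List.range (k - i)).flatMap (fun d =>
        (List.range (r (i + d))).map (fun a => (i + d, t (i + d) (a + 1))))) := by
    generalize List.range (k - i) = l
    induction l with
    | nil => simp [opProd]
    | cons d l ih =>
      rw [List.map_cons, List.prod_cons, ih]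
      simp [opProd, Function.comp_def]
  rw [hflat]
  refine (main_aux c m (m + n) T
    (fun u v huv i j k l h1 h2 h3 h4 h5 h6 h7 h8 =>
      (hRTT u v huv i j k l h1 h2 h3 h4 h5 h6 h7 h8).2)
    vac lam hdiag hann j hj1 _ ?_ ?_ (by omega)).2 s ?_
  · intro p hp
    simp only [List.mem_flatMap, List.mem_map, List.mem_range] at hp
    obtain ⟨d, hd, a, ha, rfl⟩ := hp
    simp only
    omega
  · rw [List.pairwise_flatMap]
    refine ⟨fun d hd => ?_, ?_⟩
    · rw [List.mem_range] at hd
      rw [List.pairwise_map]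
      refine List.Pairwise.imp_of_mem ?_ (List.pairwise_lt_range (n := r (i + d)))
      intro a a' ha ha' hlt
      rw [List.mem_range] at ha ha'
      apply hdist <;> first | omega | skip
      simp only [ne_eq, Prod.mk.injEq]
      omega
    · refine List.Pairwise.imp_of_mem ?_ (List.pairwise_lt_range (n := k - i))
      intro d d' hd hd' hlt p hp q hq
      simp only [List.mem_map, List.mem_range] at hd hd' hp hq
      obtain ⟨a, ha, rfl⟩ := hp
      obtain ⟨a', ha', rfl⟩ := hq
      apply hdist <;> first | omega | skip
      simp only [ne_eq, Prod.mk.injEq]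
      omega
  · intro p hp
    simp only [List.mem_flatMap, List.mem_map, List.mem_range] at hp
    obtain ⟨d, hd, a, ha, rfl⟩ := hp
    exact (hsdist (i + d) (a + 1) (by omega) (by omega) (by omega) (by omega)).symm

end Stmt14
end
end

section
/- Let V_{a,b}(u) ∈ A (1 ≤ a, b ≤ m+n, u ∈ ℂ) satisfy the graded RTT commutation relations with the gl(n|m) grading [·]_{n|m}: for all u ≠ v, V_{i,j}(u)V_{k,l}(v) − (−1)^{([i]'+[j]')([k]'+[l]')} V_{k,l}(v)V_{i,j}(u) = (−1)^{[i]'([k]'+[l]')+[k]'[l]'} g(u,v) ( V_{k,j}(v)V_{i,l}(u) − V_{k,j}(u)V_{i,l}(v) ) = (−1)^{[l]'([i]'+[j]')+[i]'[j]'} g(u,v) ( V_{i,l}(u)V_{k,j}(v) − V_{i,l}(v)V_{k,j}(u) ), where [i]' = [i]_{n|m}. Set N = m+n−1 and define W_{i,j}(u) = (−1)^{[i][j]+[j]+1} V_{N+2−j, N+2−i}(u), where [i] = [i]_{m|n}. Then the W_{i,j}(u) satisfy the graded RTT commutation relations with the gl(m|n) grading [·]_{m|n}: for all u ≠ v, W_{i,j}(u)W_{k,l}(v)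 − (−1)^{([i]+[j])([k]+[l])} W_{k,l}(v)W_{i,j}(u) = (−1)^{[i]([k]+[l])+[k][l]} g(u,v) ( W_{k,j}(v)W_{i,l}(u) − W_{k,j}(u)W_{i,l}(v) ). -/
noncomputable section

namespace Stmt17

/-- ℤ₂-grading of indices: `[i]_{m|n} = 0` for `i ≤ m`, `1` for `i > m`
(so `gr n` is the grading `[·]_{n|m}`). -/
def gr (m i : ℕ) : ℕ := if i ≤ m then 0 else 1

def g (c u v : ℂ) : ℂ := c / (u - v)

/-- The morphism `W_{i,j}(u) = (-1)^{[i][j]+[j]+1} V_{N+2-j, N+2-i}(u)`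
(with `[·] = [·]_{m|n}` and `N = m+n-1`, so `N+2-j = m+n+1-j`). -/
def W {A : Type*} [Ring A] [Algebra ℂ A] (m n : ℕ) (V : ℕ → ℕ → ℂ → A)
    (i j : ℕ) (u : ℂ) : A :=
  ((-1 : ℂ) ^ (gr m i * gr m j + gr m j + 1)) • V (m + n + 1 - j) (m + n + 1 - i) u

lemma gr_cases (m i : ℕ) : gr m i = 0 ∨ gr m i = 1 := by
  unfold gr; split_ifs <;> simp

lemma gr_flip (m n i : ℕ) (h1 : 1 ≤ i) (h2 : i ≤ m + n) :
    gr n (m + n + 1 - i) = 1 - gr m i := by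
  unfold gr; split_ifs <;> omega

/-- If `V` satisfies the graded RTT relations with the `gl(n|m)` grading, then
`W_{i,j}(u) = (-1)^{[i][j]+[j]+1} V_{N+2-j,N+2-i}(u)` satisfies the graded RTT
relations with the `gl(m|n)` grading. -/
theorem morphism_preserves_RTT {A : Type*} [Ring A] [Algebra ℂ A]
    (c : ℂ) (hc : c ≠ 0) (m n : ℕ) (hm : 1 ≤ m) (hn : 1 ≤ n)
    (V : ℕ → ℕ → ℂ → A)
    (hV : ∀ u v : ℂ, u ≠ v → ∀ i j k l : ℕ,
      1 ≤ i → i ≤ m + n → 1 ≤ j → j ≤ m + n → 1 ≤ k → k ≤ m + n → 1 ≤ l → l ≤ m + n →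
      (V i j u * V k l v
          - ((-1 : ℂ) ^ ((gr n i + gr n j) * (gr n k + gr n l))) • (V k l v * V i j u)
        = (((-1 : ℂ) ^ (gr n i * (gr n k + gr n l) + gr n k * gr n l)) * g c u v) •
            (V k j v * V i l u - V k j u * V i l v))
      ∧ (V i j u * V k l v
          - ((-1 : ℂ) ^ ((gr n i + gr n j) * (gr n k + gr n l))) • (V k l v * V i j u)
        = (((-1 : ℂ) ^ (gr n l * (gr n i + gr n j) + gr n i * gr n j)) * g c u v) •
            (V i l u * V k j v - V i l v * V k j u))) :
    ∀ u v : ℂ, u ≠ v → ∀ i j k l : ℕ,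
      1 ≤ i → i ≤ m + n → 1 ≤ j → j ≤ m + n → 1 ≤ k → k ≤ m + n → 1 ≤ l → l ≤ m + n →
      W m n V i j u * W m n V k l v
          - ((-1 : ℂ) ^ ((gr m i + gr m j) * (gr m k + gr m l))) •
              (W m n V k l v * W m n V i j u)
        = (((-1 : ℂ) ^ (gr m i * (gr m k + gr m l) + gr m k * gr m l)) * g c u v) •
            (W m n V k j v * W m n V i l u - W m n V k j u * W m n V i l v) := by
  intro u v huv i j k l hi hi' hj hj' hk hk' hl hl'
  have h := (hV u v huv (m + n + 1 - j) (m + n + 1 - i) (m + n + 1 - l) (m + n + 1 - k)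
    (by omega) (by omega) (by omega) (by omega) (by omega) (by omega) (by omega) (by omega)).2
  rw [gr_flip m n i hi hi', gr_flip m n j hj hj', gr_flip m n k hk hk',
    gr_flip m n l hl hl'] at h
  unfold W
  generalize V (m + n + 1 - j) (m + n + 1 - i) u = X1 at *
  generalize V (m + n + 1 - l) (m + n + 1 - k) v = X2 at *
  simp only [smul_mul_smul_comm]
  rcases gr_cases m i with a | a <;> rcases gr_cases m j with b | b <;>
  rcases gr_cases m k with d | d <;> rcases gr_cases m l with e | e <;>
  · simp only [a, b, d, e] at h ⊢
    norm_num at h ⊢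
    try simp only [smul_sub, smul_add, neg_smul, smul_neg] at h ⊢
    rw [← sub_eq_zero] at h ⊢
    first
    | exact h
    | (refine Eq.trans ?_ h; abel1)
    | (refine neg_eq_zero.mp (Eq.trans ?_ h); abel1)

end Stmt17
end
end
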